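/- Let d ≥ 1 and N ≥ 1, let Σ₀,…,Σ_N be symmetric positive semidefinite d × d real matrices, and define the 2d × 2d matrices Q = [[12,−6],[−6,4]] ⊗ I_d and Φ = [[1,1],[0,1]] ⊗ I_d. Consider the semidefinite program: minimize Σ_{i=0}^{N−1} Tr( Q·Σ̂_{i+1} + Φᵀ·Q·Φ·Σ̂_i − 2·Q·Φ·S_i ) over all symmetric positive semidefinite 2d(N+1) × 2d(N+1) matrices Σ̂, where Σ̂_i denotes the (i,i) 2d × 2d diagonal block of Σ̂ and S_i the (i,i+1) 2d × 2d block of Σ̂, subject to the constraint that the upper-left d × d block of Σ̂_i equals Σ_i for every i = 0,…,N. Then this program has at least one optimal solution Σ̂ whose rank is at most 2d. -/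

import Mathlib

open Matrix Kronecker

noncomputable section

/-- `Q = [[12,−6],[−6,4]] ⊗ I_d`. -/
def Qmat (d : ℕ) : Matrix (Fin 2 × Fin d) (Fin 2 × Fin d) ℝ :=
  (!![12, -6; -6, 4] : Matrix (Fin 2) (Fin 2) ℝ) ⊗ₖ (1 : Matrix (Fin d) (Fin d) ℝ)

/-- `Φ = [[1,1],[0,1]] ⊗ I_d`. -/
def Phimat (d : ℕ) : Matrix (Fin 2 × Fin d) (Fin 2 × Fin d) ℝ :=
  (!![1, 1; 0, 1] : Matrix (Fin 2) (Fin 2) ℝ) ⊗ₖ (1 : Matrix (Fin d) (Fin d) ℝ)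

/-- The SDP cost `L = Σ_{i=0}^{N−1} Tr(Q Σ̂_{i+1} + Φᵀ Q Φ Σ̂_i − 2 Q Φ S_i)`,
evaluated on the diagonal and superdiagonal `2d × 2d` blocks of a big matrix `M`. -/
def sdpCostM (d N : ℕ)
    (M : Matrix (Fin (N + 1) × (Fin 2 × Fin d)) (Fin (N + 1) × (Fin 2 × Fin d)) ℝ) : ℝ :=
  ∑ i : Fin N,
    (Qmat d * Matrix.of (fun a b => M (i.succ, a) (i.succ, b))
      + (Phimat d)ᵀ * Qmat d * Phimat d * Matrix.of (fun a b => M (i.castSucc, a) (i.castSucc, b))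
      - (2:ℝ) • (Qmat d * Phimat d * Matrix.of fun a b => M (i.castSucc, a) (i.succ, b))).trace

open scoped MatrixOrder in
/-- The matrix of the optimal transport map between two nondegenerate Gaussian covariances. -/
lemma exists_posDef_mul_mul_eq {n : Type*} [Fintype n] [DecidableEq n] {a s : Matrix n n ℝ}
    (ha : a.PosDef) (hs : s.PosDef) : ∃ T : Matrix n n ℝ, T.PosDef ∧ T * a * T = s := by
  have hsqrt : ∀ {b : Matrix n n ℝ}, b.PosDef → ∃ r : Matrix n n ℝ, r.PosDef ∧ r * r = b := by
    intro b hb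
    have hr : CFC.sqrt b * CFC.sqrt b = b := CFC.sqrt_mul_sqrt_self b hb.posSemidef.nonneg
    refine ⟨CFC.sqrt b, ?_, hr⟩
    refine (nonneg_iff_posSemidef.1 (CFC.sqrt_nonneg b)).posDef_iff_isUnit.2 ?_
    have hu := hb.isUnit
    rw [← hr] at hu
    exact isUnit_of_mul_isUnit_left hu
  obtain ⟨r, hr, hra⟩ := hsqrt ha
  have hrt : rᴴ = r := hr.isHermitian
  have hdet : IsUnit r.det := (Matrix.isUnit_iff_isUnit_det r).1 hr.isUnit
  obtain ⟨q, hq, hqq⟩ := hsqrt (b := rᴴ * s * r)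
    (hs.conjTranspose_mul_mul_same (mulVec_injective_of_isUnit hr.isUnit))
  have hinv : r⁻¹ᴴ = r⁻¹ := hr.inv.isHermitian
  refine ⟨r⁻¹ᴴ * q * r⁻¹,
    hq.conjTranspose_mul_mul_same (mulVec_injective_of_isUnit hr.inv.isUnit), ?_⟩
  rw [hrt] at hqq
  rw [hinv, ← hra]
  have h1 : r⁻¹ * r = 1 := nonsing_inv_mul r hdet
  have h2 : r * r⁻¹ = 1 := mul_nonsing_inv r hdet
  calc r⁻¹ * q * r⁻¹ * (r * r) * (r⁻¹ * q * r⁻¹)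
      = r⁻¹ * q * (r⁻¹ * r) * (r * r⁻¹) * q * r⁻¹ := by simp only [Matrix.mul_assoc]
    _ = r⁻¹ * (q * q) * r⁻¹ := by rw [h1, h2]; simp only [Matrix.mul_assoc, Matrix.mul_one]
    _ = (r⁻¹ * r) * s * (r * r⁻¹) := by rw [hqq]; simp only [Matrix.mul_assoc]
    _ = s := by rw [h1, h2]; simp

/-- The best correlation with a nondegenerate factor is attained without adding columns. -/
lemma exists_factor_trace_le {n K : Type*} [Fintype n] [DecidableEq n] [Fintype K]
    {A G : Matrix n n ℝ} {X Y : Matrix n K ℝ} (hA : IsUnit A) (hG : G * Gᵀ = X * Xᵀ)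
    (hX : (X * Xᵀ).PosDef) (hY : (Y * Yᵀ).PosDef) :
    ∃ H : Matrix n n ℝ, H * Hᵀ = Y * Yᵀ ∧ (A * (X * Yᵀ)).trace ≤ (A * (G * Hᵀ)).trace := by
  have ha : (A * (X * Xᵀ) * Aᵀ).PosDef := by
    rw [← conjTranspose_eq_transpose_of_trivial A]
    exact hX.mul_mul_conjTranspose_same (vecMul_injective_of_isUnit hA)
  obtain ⟨T, hT, hTs⟩ := exists_posDef_mul_mul_eq ha hY
  have hTt : Tᵀ = T := by
    rw [← conjTranspose_eq_transpose_of_trivial]; exact hT.isHermitian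
  have hdet : IsUnit T.det := (Matrix.isUnit_iff_isUnit_det T).1 hT.isUnit
  have hTi : T * T⁻¹ = 1 := mul_nonsing_inv T hdet
  have hTi' : T⁻¹ * T = 1 := nonsing_inv_mul T hdet
  refine ⟨T * A * G, ?_, ?_⟩
  · rw [← hTs, ← hG]
    simp only [transpose_mul, hTt, Matrix.mul_assoc]
  · have hpos := (hT.inv.posSemidef.conjTranspose_mul_mul_same (T * A * X - Y)).trace_nonneg
    have hrhs : (A * (G * (T * A * G)ᵀ)).trace = (T * (A * (X * Xᵀ) * Aᵀ)).trace := by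
      rw [transpose_mul, transpose_mul, hTt, ← hG, trace_mul_comm T]
      simp only [Matrix.mul_assoc]
    have hexp : (T * A * X - Y)ᴴ * T⁻¹ * (T * A * X - Y)
        = Xᵀ * Aᵀ * T * A * X - Xᵀ * Aᵀ * Y - Yᵀ * A * X + Yᵀ * T⁻¹ * Y := by
      have e1 : Xᵀ * (Aᵀ * (T * (T⁻¹ * (T * (A * X))))) = Xᵀ * (Aᵀ * (T * (A * X))) := by
        rw [← Matrix.mul_assoc T⁻¹, hTi', Matrix.one_mul]
      have e2 : Xᵀ * (Aᵀ * (T * (T⁻¹ * Y))) = Xᵀ * (Aᵀ * Y) := by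
        rw [← Matrix.mul_assoc T, hTi, Matrix.one_mul]
      have e3 : Yᵀ * (T⁻¹ * (T * (A * X))) = Yᵀ * (A * X) := by
        rw [← Matrix.mul_assoc T⁻¹, hTi', Matrix.one_mul]
      rw [conjTranspose_eq_transpose_of_trivial]
      simp only [transpose_sub, transpose_mul, hTt, Matrix.sub_mul, Matrix.mul_sub,
        Matrix.mul_assoc, e1, e2, e3]
      abel
    have t1 : (Xᵀ * Aᵀ * T * A * X).trace = (T * (A * (X * Xᵀ) * Aᵀ)).trace := by
      rw [show Xᵀ * Aᵀ * T * A * X = (Xᵀ * Aᵀ) * (T * A * X) by simp only [Matrix.mul_assoc],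
        trace_mul_comm]
      simp only [Matrix.mul_assoc]
    have t2 : (Xᵀ * Aᵀ * Y).trace = (A * (X * Yᵀ)).trace := by
      rw [← trace_transpose]
      simp only [transpose_mul, transpose_transpose]
      rw [trace_mul_comm, Matrix.mul_assoc]
    have t3 : (Yᵀ * A * X).trace = (A * (X * Yᵀ)).trace := by
      rw [Matrix.mul_assoc, trace_mul_comm, Matrix.mul_assoc]
    have t4 : (Yᵀ * T⁻¹ * Y).trace = (T * (A * (X * Xᵀ) * Aᵀ)).trace := by
      rw [trace_mul_comm, ← Matrix.mul_assoc, ← hTs, trace_mul_comm, ← Matrix.mul_assoc,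
        ← Matrix.mul_assoc, hTi', Matrix.one_mul, trace_mul_comm]
    rw [hexp, trace_add, trace_sub, trace_sub, t1, t2, t3, t4] at hpos
    rw [hrhs]
    linarith

/-- A chain of nondegenerate factors can be replaced by square ones with the same Gram matrices
and consecutive correlations at least as good. -/
lemma exists_chain_factor {n K : Type*} [Fintype n] [DecidableEq n] [Fintype K]
    {A : Matrix n n ℝ} (hA : IsUnit A) (N : ℕ) (B : Fin (N + 1) → Matrix n K ℝ)
    (hB : ∀ i, (B i * (B i)ᵀ).PosDef) :
    ∃ G : Fin (N + 1) → Matrix n n ℝ, (∀ i, G i * (G i)ᵀ = B i * (B i)ᵀ) ∧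
      ∀ i : Fin N, (A * (B i.castSucc * (B i.succ)ᵀ)).trace
        ≤ (A * (G i.castSucc * (G i.succ)ᵀ)).trace := by
  induction N with
  | zero =>
    obtain ⟨T, hT, h⟩ := exists_posDef_mul_mul_eq PosDef.one (hB 0)
    refine ⟨fun _ => T, fun i => ?_, fun i => i.elim0⟩
    rw [Fin.fin_one_eq_zero i, ← h, Matrix.mul_one, ← conjTranspose_eq_transpose_of_trivial,
      hT.isHermitian]
  | succ N ih =>
    obtain ⟨G, hG, hGt⟩ := ih (fun i => B i.castSucc) (fun i => hB _)
    obtain ⟨H, hH, hHt⟩ := exists_factor_trace_le hA (hG (Fin.last N)) (hB _)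
      (hB (Fin.last (N + 1)))
    refine ⟨Fin.snoc (α := fun _ => Matrix n n ℝ) G H, fun i => ?_, fun i => ?_⟩
    · induction i using Fin.lastCases with
      | last => simpa using hH
      | cast i => simpa using hG i
    · induction i using Fin.lastCases with
      | last => simpa only [Fin.snoc_castSucc, Fin.succ_last, Fin.snoc_last] using hHt
      | cast i => simpa only [Fin.snoc_castSucc, Fin.succ_castSucc] using hGt i

lemma Qmat_mul_Phimat (d : ℕ) : Qmat d * Phimat d =
    (!![12, 6; -6, -2] : Matrix (Fin 2) (Fin 2) ℝ) ⊗ₖ (1 : Matrix (Fin d) (Fin d) ℝ) := by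
  rw [Qmat, Phimat, ← mul_kronecker_mul, Matrix.one_mul]
  congr 1
  ext i j
  fin_cases i <;> fin_cases j <;> norm_num [Matrix.mul_apply, Fin.sum_univ_two]

lemma Phimat_transpose_mul_Qmat_mul_Phimat (d : ℕ) : (Phimat d)ᵀ * Qmat d * Phimat d =
    (!![12, 6; 6, 4] : Matrix (Fin 2) (Fin 2) ℝ) ⊗ₖ (1 : Matrix (Fin d) (Fin d) ℝ) := by
  rw [Matrix.mul_assoc, Qmat_mul_Phimat, Phimat, ← kroneckerMap_transpose, ← mul_kronecker_mul,
    transpose_one, Matrix.one_mul]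
  congr 1
  ext i j
  fin_cases i <;> fin_cases j <;> norm_num [Matrix.mul_apply, Fin.sum_univ_two]

lemma isUnit_Qmat_mul_Phimat (d : ℕ) : IsUnit (Qmat d * Phimat d) := by
  refine IsUnit.of_mul_eq_one
    ((!![-1 / 6, -1 / 2; 1 / 2, 1] : Matrix (Fin 2) (Fin 2) ℝ) ⊗ₖ (1 : Matrix (Fin d) (Fin d) ℝ)) ?_
  rw [Qmat_mul_Phimat, ← mul_kronecker_mul, Matrix.one_mul, ← one_kronecker_one]
  congr 1
  ext i j
  fin_cases i <;> fin_cases j <;> norm_num [Matrix.mul_apply, Fin.sum_univ_two]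

lemma trace_kronecker_one_mul {d : ℕ} (c : Matrix (Fin 2) (Fin 2) ℝ)
    (B : Matrix (Fin 2 × Fin d) (Fin 2 × Fin d) ℝ) :
    ((c ⊗ₖ (1 : Matrix (Fin d) (Fin d) ℝ)) * B).trace =
      ∑ k, (c 0 0 * B (0, k) (0, k) + c 0 1 * B (1, k) (0, k)
        + c 1 0 * B (0, k) (1, k) + c 1 1 * B (1, k) (1, k)) := by
  simp only [trace, diag_apply, Matrix.mul_apply, Fintype.sum_prod_type, Fin.sum_univ_two,
    kroneckerMap_apply, Matrix.one_apply, mul_ite, mul_one, mul_zero, ite_mul, zero_mul,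
    Finset.sum_ite_eq, Finset.mem_univ, if_true, ← Finset.sum_add_distrib]
  exact Finset.sum_congr rfl fun k _ => by ring

/-- The cost of a Gram matrix is a sum of squares of the transition residuals. -/
lemma sdpCostM_mul_transpose {d N : ℕ} {K : Type*} [Fintype K]
    (G : Matrix (Fin (N + 1) × (Fin 2 × Fin d)) K ℝ) :
    sdpCostM d N (G * Gᵀ) = ∑ i : Fin N, ∑ k : Fin d, ∑ j : K,
      (3 * (G (i.succ, (0, k)) j - G (i.castSucc, (0, k)) j - G (i.castSucc, (1, k)) j) ^ 2
        + (3 * (G (i.succ, (0, k)) j - G (i.castSucc, (0, k)) j - G (i.castSucc, (1, k)) j)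
          - 2 * (G (i.succ, (1, k)) j - G (i.castSucc, (1, k)) j)) ^ 2) := by
  refine Finset.sum_congr rfl fun i _ => ?_
  rw [Phimat_transpose_mul_Qmat_mul_Phimat, Qmat_mul_Phimat, Qmat, trace_sub, trace_add,
    trace_smul, trace_kronecker_one_mul, trace_kronecker_one_mul, trace_kronecker_one_mul,
    smul_eq_mul, Finset.mul_sum, ← Finset.sum_add_distrib, ← Finset.sum_sub_distrib]
  refine Finset.sum_congr rfl fun k _ => ?_
  simp only [of_apply, Matrix.mul_apply, transpose_apply, cons_val', cons_val_zero, cons_val_one,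
    cons_val_fin_one, Finset.mul_sum, ← Finset.sum_add_distrib, ← Finset.sum_sub_distrib]
  exact Finset.sum_congr rfl fun j _ => by ring

lemma continuous_sdpCostM (d N : ℕ) : Continuous (sdpCostM d N) := by
  refine continuous_finsetSum _ fun i _ => Continuous.matrix_trace ?_
  have hblk : ∀ i j : Fin (N + 1), Continuous fun
      M : Matrix (Fin (N + 1) × (Fin 2 × Fin d)) (Fin (N + 1) × (Fin 2 × Fin d)) ℝ =>
        of fun a b => M (i, a) (j, b) :=
    fun i j => continuous_id.matrix_submatrix (Prod.mk i) (Prod.mk j)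
  exact ((Continuous.matrix_mul continuous_const (hblk _ _)).add
    (Continuous.matrix_mul continuous_const (hblk _ _))).sub
      ((Continuous.matrix_mul continuous_const (hblk _ _)).const_smul (2 : ℝ))

lemma sdpCostM_le_sdpCostM {d N : ℕ}
    {M M' : Matrix (Fin (N + 1) × (Fin 2 × Fin d)) (Fin (N + 1) × (Fin 2 × Fin d)) ℝ}
    (hdiag : ∀ i a b, M (i, a) (i, b) = M' (i, a) (i, b))
    (htr : ∀ i : Fin N,
      (Qmat d * Phimat d * M'.submatrix (Prod.mk i.castSucc) (Prod.mk i.succ)).trace ≤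
        (Qmat d * Phimat d * M.submatrix (Prod.mk i.castSucc) (Prod.mk i.succ)).trace) :
    sdpCostM d N M ≤ sdpCostM d N M' := by
  refine Finset.sum_le_sum fun i _ => ?_
  simp only [trace_sub, trace_smul, smul_eq_mul, hdiag]
  have := htr i
  simp only [submatrix] at this
  linarith

/-- A positive definite matrix can be replaced by a Gram matrix with `2d` columns, the same
diagonal blocks, and no larger cost. -/
lemma exists_factor_sdpCostM_le {d N : ℕ}
    {M : Matrix (Fin (N + 1) × (Fin 2 × Fin d)) (Fin (N + 1) × (Fin 2 × Fin d)) ℝ}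
    (hM : M.PosDef) :
    ∃ G : Matrix (Fin (N + 1) × (Fin 2 × Fin d)) (Fin 2 × Fin d) ℝ,
      (∀ i a b, (G * Gᵀ) (i, a) (i, b) = M (i, a) (i, b)) ∧
      sdpCostM d N (G * Gᵀ) ≤ sdpCostM d N M := by
  obtain ⟨T, hT, hTM⟩ := exists_posDef_mul_mul_eq PosDef.one hM
  have hTt : Tᵀ = T := by
    rw [← conjTranspose_eq_transpose_of_trivial]; exact hT.isHermitian
  have hTM' : T * Tᵀ = M := by rw [hTt, ← hTM, Matrix.mul_one]
  have hblk : ∀ i j, T.submatrix (Prod.mk i) id * (T.submatrix (Prod.mk j) id)ᵀ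
      = M.submatrix (Prod.mk i) (Prod.mk j) := by
    intro i j
    rw [← hTM']
    rfl
  obtain ⟨G, hG, hGt⟩ := exists_chain_factor (isUnit_Qmat_mul_Phimat d) N
    (fun i => T.submatrix (Prod.mk i) id) (fun i => by
      rw [hblk]
      exact hM.submatrix (Prod.mk_right_injective i))
  have hdiag : ∀ i a b, ((of fun p j => G p.1 p.2 j) * (of fun p j => G p.1 p.2 j)ᵀ) (i, a) (i, b)
      = M (i, a) (i, b) := by
    intro i a b
    have := congrFun (congrFun ((hG i).trans (hblk i i)) a) b
    exact this
  refine ⟨of fun p j => G p.1 p.2 j, hdiag, sdpCostM_le_sdpCostM hdiag fun i => ?_⟩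
  have := hGt i
  rw [hblk] at this
  exact this

lemma isCompact_of_isClosed_of_abs_le {m n : Type*} {S : Set (Matrix m n ℝ)} (hS : IsClosed S)
    (R : ℝ) (hR : ∀ G ∈ S, ∀ i j, |G i j| ≤ R) : IsCompact S := by
  have hc : IsCompact (Set.pi Set.univ fun _ : m => Set.pi Set.univ fun _ : n => Set.Icc (-R) R) :=
    isCompact_univ_pi fun _ => isCompact_univ_pi fun _ => isCompact_Icc
  exact hc.of_isClosed_subset hS fun G hG i _ j _ => abs_le.1 (hR G hG i j)

lemma sq_le_mul_transpose_apply {m n : Type*} [Fintype n] (G : Matrix m n ℝ) (i : m) (j : n) :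
    G i j ^ 2 ≤ (G * Gᵀ) i i := by
  simp only [Matrix.mul_apply, transpose_apply, ← sq]
  exact Finset.single_le_sum (f := fun j => G i j ^ 2) (fun _ _ => sq_nonneg _) (Finset.mem_univ j)

lemma abs_le_add_one_of_sq_le {x c : ℝ} (h : x ^ 2 ≤ c) : |x| ≤ c + 1 := by
  rw [← sq_abs] at h
  nlinarith [sq_nonneg (|x| - 1), abs_nonneg x]

/-- The positive semidefinite version of `exists_factor_sdpCostM_le`. -/
lemma exists_factor_sdpCostM_le_of_posSemidef {d N : ℕ}
    {M : Matrix (Fin (N + 1) × (Fin 2 × Fin d)) (Fin (N + 1) × (Fin 2 × Fin d)) ℝ}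
    (hM : M.PosSemidef) :
    ∃ G : Matrix (Fin (N + 1) × (Fin 2 × Fin d)) (Fin 2 × Fin d) ℝ,
      (∀ i a b, (G * Gᵀ) (i, a) (i, b) = M (i, a) (i, b)) ∧
      sdpCostM d N (G * Gᵀ) ≤ sdpCostM d N M := by
  set C : Set (ℝ × Matrix (Fin (N + 1) × (Fin 2 × Fin d)) (Fin 2 × Fin d) ℝ) :=
    {x | ∀ i a b, (x.2 * x.2ᵀ) (i, a) (i, b) = (M + x.1 • 1) (i, a) (i, b)} ∩
      {x | sdpCostM d N (x.2 * x.2ᵀ) ≤ sdpCostM d N (M + x.1 • 1)}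
  have hgram : Continuous fun x : ℝ × Matrix (Fin (N + 1) × (Fin 2 × Fin d)) (Fin 2 × Fin d) ℝ =>
      x.2 * x.2ᵀ := continuous_snd.matrix_mul continuous_snd.matrix_transpose
  have hpert : Continuous fun x : ℝ × Matrix (Fin (N + 1) × (Fin 2 × Fin d)) (Fin 2 × Fin d) ℝ =>
      M + x.1 • (1 : Matrix (Fin (N + 1) × (Fin 2 × Fin d)) (Fin (N + 1) × (Fin 2 × Fin d)) ℝ) :=
    continuous_const.add (continuous_fst.smul continuous_const)
  have hclosed : IsClosed C := by
    refine IsClosed.inter ?_ (isClosed_le ((continuous_sdpCostM d N).comp hgram)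
      ((continuous_sdpCostM d N).comp hpert))
    simp only [Set.ofPred_forall]
    exact isClosed_iInter fun i => isClosed_iInter fun a => isClosed_iInter fun b =>
      isClosed_eq (hgram.matrix_elem _ _) (hpert.matrix_elem _ _)
  have hbox : IsCompact {G : Matrix (Fin (N + 1) × (Fin 2 × Fin d)) (Fin 2 × Fin d) ℝ |
      ∀ i j, |G i j| ≤ M.trace + 2} := by
    refine isCompact_of_isClosed_of_abs_le ?_ (M.trace + 2) fun G hG => hG
    simp only [Set.ofPred_forall]
    exact isClosed_iInter fun i => isClosed_iInter fun j =>
      isClosed_le (continuous_id.matrix_elem i j).abs continuous_const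
  have hcomp := ((isCompact_Icc (a := (0 : ℝ)) (b := 1)).prod hbox).inter_right hclosed
  have hsub : Set.Ioc (0 : ℝ) 1 ⊆ Prod.fst '' (Set.Icc (0 : ℝ) 1 ×ˢ
      {G : Matrix (Fin (N + 1) × (Fin 2 × Fin d)) (Fin 2 × Fin d) ℝ |
        ∀ i j, |G i j| ≤ M.trace + 2} ∩ C) := by
    intro ε hε
    obtain ⟨G, hG, hGc⟩ := exists_factor_sdpCostM_le
      (PosDef.posSemidef_add hM (PosDef.one.smul hε.1))
    refine ⟨(ε, G), ⟨⟨⟨hε.1.le, hε.2⟩, fun i j => ?_⟩, hG, hGc⟩, rfl⟩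
    have h1 := sq_le_mul_transpose_apply G i j
    have h2 := hG i.1 i.2 i.2
    have h3 : M i i ≤ M.trace :=
      Finset.single_le_sum (f := fun i => M i i) (fun i _ => hM.diag_nonneg) (Finset.mem_univ i)
    have h4 : G i j ^ 2 ≤ M.trace + 1 := by
      simp only [Prod.mk.eta, Matrix.add_apply, Matrix.smul_apply, one_apply_eq, smul_eq_mul,
        mul_one] at h2
      linarith [hε.2]
    linarith [abs_le_add_one_of_sq_le h4]
  have hzero := closure_minimal hsub (hcomp.image continuous_fst).isClosed
  rw [closure_Ioc zero_ne_one] at hzero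
  obtain ⟨⟨ε, G⟩, ⟨-, hG, hGc⟩, rfl⟩ := hzero (Set.left_mem_Icc.2 zero_le_one)
  refine ⟨G, ?_, ?_⟩
  · simpa using hG
  · simpa using hGc

/-- Prescribed position blocks and a bound on the cost bound all entries of a factor. -/
lemma abs_le_of_sdpCostM_le {d N : ℕ} {K : Type*} [Fintype K] (hN : 1 ≤ N)
    {G : Matrix (Fin (N + 1) × (Fin 2 × Fin d)) K ℝ} {p c : ℝ}
    (hp : ∀ i k, (G * Gᵀ) (i, (0, k)) (i, (0, k)) ≤ p) (hc : sdpCostM d N (G * Gᵀ) ≤ c)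
    (i : Fin (N + 1) × (Fin 2 × Fin d)) (j : K) : |G i j| ≤ 2 * (p + 1) + 3 * (c + 1) := by
  have hpos : ∀ i k, |G (i, (0, k)) j| ≤ p + 1 := fun i k =>
    abs_le_add_one_of_sq_le ((sq_le_mul_transpose_apply G _ j).trans (hp i k))
  have hres : ∀ (i : Fin N) (k : Fin d),
      3 * (G (i.succ, (0, k)) j - G (i.castSucc, (0, k)) j - G (i.castSucc, (1, k)) j) ^ 2
        + (3 * (G (i.succ, (0, k)) j - G (i.castSucc, (0, k)) j - G (i.castSucc, (1, k)) j)
          - 2 * (G (i.succ, (1, k)) j - G (i.castSucc, (1, k)) j)) ^ 2 ≤ c := by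
    intro i k
    rw [sdpCostM_mul_transpose] at hc
    refine le_trans ?_ hc
    refine le_trans ?_ (Finset.single_le_sum (fun i _ => Finset.sum_nonneg fun k _ =>
      Finset.sum_nonneg fun j _ => by positivity) (Finset.mem_univ i))
    refine le_trans ?_ (Finset.single_le_sum (fun k _ =>
      Finset.sum_nonneg fun j _ => by positivity) (Finset.mem_univ k))
    exact Finset.single_le_sum (f := fun j =>
      3 * (G (i.succ, (0, k)) j - G (i.castSucc, (0, k)) j - G (i.castSucc, (1, k)) j) ^ 2
        + (3 * (G (i.succ, (0, k)) j - G (i.castSucc, (0, k)) j - G (i.castSucc, (1, k)) j)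
          - 2 * (G (i.succ, (1, k)) j - G (i.castSucc, (1, k)) j)) ^ 2)
      (fun j _ => by positivity) (Finset.mem_univ j)
  have hvel : ∀ (i : Fin N) (k : Fin d),
      |G (i.castSucc, (1, k)) j| ≤ 2 * (p + 1) + (c + 1) ∧
      |G (i.succ, (1, k)) j| ≤ 2 * (p + 1) + 3 * (c + 1) := by
    intro i k
    have h := hres i k
    set e := G (i.succ, (0, k)) j - G (i.castSucc, (0, k)) j - G (i.castSucc, (1, k)) j
    set f := G (i.succ, (1, k)) j - G (i.castSucc, (1, k)) j
    have h1 := abs_le.1 (abs_le_add_one_of_sq_le (x := e) (c := c) (by nlinarith))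
    have h2 := abs_le.1 (abs_le_add_one_of_sq_le (x := 3 * e - 2 * f) (c := c) (by nlinarith))
    have h3 := abs_le.1 (hpos i.succ k)
    have h4 := abs_le.1 (hpos i.castSucc k)
    constructor <;> rw [abs_le] <;> constructor <;> linarith
  have hc0 : 0 ≤ c := by
    refine le_trans ?_ hc
    rw [sdpCostM_mul_transpose]
    positivity
  obtain ⟨i, b, k⟩ := i
  have hp0 := (abs_nonneg _).trans (hpos i k)
  fin_cases b
  · exact (hpos i k).trans (by linarith)
  · induction i using Fin.lastCases with
    | last =>
      obtain ⟨N, rfl⟩ := Nat.exists_eq_succ_of_ne_zero (Nat.one_le_iff_ne_zero.1 hN)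
      exact (hvel (Fin.last N) k).2
    | cast i => exact (hvel i k).1.trans (by linarith)

open scoped MatrixOrder in
lemma exists_factor_position_blocks {d N : ℕ} {Sig : Fin (N + 1) → Matrix (Fin d) (Fin d) ℝ}
    (hSig : ∀ i, (Sig i).PosSemidef) :
    ∃ G : Matrix (Fin (N + 1) × (Fin 2 × Fin d)) (Fin 2 × Fin d) ℝ,
      ∀ i k l, (G * Gᵀ) (i, (0, k)) (i, (0, l)) = Sig i k l := by
  refine ⟨of fun p j => if j.1 = 0 then CFC.sqrt (Sig p.1) p.2.2 j.2 else 0, fun i k l => ?_⟩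
  have hr : CFC.sqrt (Sig i) * CFC.sqrt (Sig i) = Sig i :=
    CFC.sqrt_mul_sqrt_self (Sig i) (hSig i).nonneg
  have ht : ∀ a b, CFC.sqrt (Sig i) a b = CFC.sqrt (Sig i) b a := fun a b =>
    (nonneg_iff_posSemidef.1 (CFC.sqrt_nonneg (Sig i))).isHermitian.apply b a
  rw [Matrix.mul_apply, Fintype.sum_prod_type]
  simp only [Fin.sum_univ_two, of_apply, transpose_apply, if_true, one_ne_zero, if_false, mul_zero,
    Finset.sum_const_zero, add_zero]
  conv_rhs => rw [← hr, Matrix.mul_apply]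
  exact Finset.sum_congr rfl fun a _ => by rw [ht l a]

/-- The SDP over PSD `2d(N+1) × 2d(N+1)` matrices with prescribed position-position
diagonal blocks has an optimal solution of rank at most `2d`. -/
theorem stmt17 (d N : ℕ) (hd : 1 ≤ d) (hN : 1 ≤ N)
    (Sig : Fin (N + 1) → Matrix (Fin d) (Fin d) ℝ)
    (hSig : ∀ i, (Sig i).PosSemidef) :
    ∃ M : Matrix (Fin (N + 1) × (Fin 2 × Fin d)) (Fin (N + 1) × (Fin 2 × Fin d)) ℝ,
      M.PosSemidef ∧
      (∀ (i : Fin (N + 1)) (k l : Fin d),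
        M (i, ((0 : Fin 2), k)) (i, ((0 : Fin 2), l)) = Sig i k l) ∧
      M.rank ≤ 2 * d ∧
      ∀ M' : Matrix (Fin (N + 1) × (Fin 2 × Fin d)) (Fin (N + 1) × (Fin 2 × Fin d)) ℝ,
        M'.PosSemidef →
        (∀ (i : Fin (N + 1)) (k l : Fin d),
          M' (i, ((0 : Fin 2), k)) (i, ((0 : Fin 2), l)) = Sig i k l) →
        sdpCostM d N M ≤ sdpCostM d N M' := by
  set F : Set (Matrix (Fin (N + 1) × (Fin 2 × Fin d)) (Fin 2 × Fin d) ℝ) :=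
    {G | ∀ i k l, (G * Gᵀ) (i, (0, k)) (i, (0, l)) = Sig i k l} with hF
  obtain ⟨G₀, hG₀⟩ := exists_factor_position_blocks hSig
  have hgram : Continuous fun G : Matrix (Fin (N + 1) × (Fin 2 × Fin d)) (Fin 2 × Fin d) ℝ =>
      G * Gᵀ := continuous_id.matrix_mul continuous_id.matrix_transpose
  have hcost := (continuous_sdpCostM d N).comp hgram
  have hclosed : IsClosed (F ∩ {G | sdpCostM d N (G * Gᵀ) ≤ sdpCostM d N (G₀ * G₀ᵀ)}) := by
    refine IsClosed.inter ?_ (isClosed_le hcost continuous_const)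
    simp only [hF, Set.ofPred_forall]
    exact isClosed_iInter fun i => isClosed_iInter fun k => isClosed_iInter fun l =>
      isClosed_eq (hgram.matrix_elem _ _) continuous_const
  have hp : ∀ i k, Sig i k k ≤ ∑ i, (Sig i).trace := fun i k =>
    (Finset.single_le_sum (f := fun k => Sig i k k) (fun k _ => (hSig i).diag_nonneg)
      (Finset.mem_univ k)).trans (Finset.single_le_sum (f := fun i => (Sig i).trace)
        (fun i _ => (hSig i).trace_nonneg) (Finset.mem_univ i))
  have hcomp := isCompact_of_isClosed_of_abs_le hclosed _ fun G hG =>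
    abs_le_of_sdpCostM_le hN (fun i k => (hG.1 i k k).trans_le (hp i k)) hG.2
  obtain ⟨G, ⟨hGF, hG⟩, hmin⟩ := hcomp.exists_isMinOn
    ⟨G₀, hG₀, le_refl (sdpCostM d N (G₀ * G₀ᵀ))⟩ hcost.continuousOn
  refine ⟨G * Gᵀ, ?_, hGF, ?_, fun M' hM' hpos => ?_⟩
  · rw [← conjTranspose_eq_transpose_of_trivial]
    exact posSemidef_self_mul_conjTranspose G
  · simpa using (rank_mul_le_left G Gᵀ).trans (rank_le_card_width G)
  · obtain ⟨H, hHdiag, hH⟩ := exists_factor_sdpCostM_le_of_posSemidef hM'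
    refine le_trans ?_ hH
    rcases le_total (sdpCostM d N (H * Hᵀ)) (sdpCostM d N (G₀ * G₀ᵀ)) with h | h
    · exact hmin ⟨fun i k l => (hHdiag i _ _).trans (hpos i k l), h⟩
    · exact le_trans hG h
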